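/- (Theorem 6, concretized.) Fix a process i with prefix H_i and a legal initiation function I_i : {0,…,|H_i|−1} → ℕ (i.e., I_i(m) + dur(H_i[m]) ≤ I_i(m+1) for all m < |H_i|−1). For each process j, let k_j be the least index at which H_j and H_i differ (k_j = min(|H_i|, |H_j|) if one is a prefix of the other), for m < k_j let t_{j,m} = d_j − ∑_{r=m}^{|H_j|−1} dur(H_j[r]) (truncated subtraction in ℕ), and define the effective deadline d_j^eff as the minimum of the set {d_j} ∪ { I_i(k_j) | if k_j < |H_i| } ∪ { t_{j,m} : m < k_j and t_{j,m} < I_i(m) }. Consider schedules that assign to each process j a start time b_j ∈ ℕ and duration t_j ∈ ℕ with pairwise disjoint intervals [b_j, b_j + t_j), with process j's success probability s_j = M_j(min(t_j, d_j^eff − b_j)) if b_j ≤ d_j^eff and s_j = 0 otherwise, and overall success probability 1 − ∏_j (1 − s_j). Then for every such schedule there exists another such schedule whose blocks of positive duration are back-to-back from time 0, end no later than the respective effective deadlines, occur in nondecreasing order of the effective deadlines d_j^eff, and whose overall success probability is at least that of the given schedule. -/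

import Mathlib

/-- The length of the longest common prefix of two lists, i.e. the least index at
which the two lists differ (equal to the shorter length if one is a prefix of the
other). -/
def commonPrefixLen {B : Type*} [DecidableEq B] : List B → List B → ℕ
  | a :: as, b :: bs => if a = b then commonPrefixLen as bs + 1 else 0
  | _, _ => 0

/-- The total duration of the actions `Hj[m], …, Hj[|Hj|-1]`. -/
def suffixDur {B : Type*} (dur : B → ℕ) (Hj : List B) (m : ℕ) : ℕ :=
  ((Hj.drop m).map dur).sum

/-- The effective deadline `d_j^eff` of process `j`, given that base-level execution
follows the prefix `H i` with initiation function `I`: the minimum of the set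
`{d j} ∪ {I k_j | if k_j < |H i|} ∪ {t_{j,m} : m < k_j and t_{j,m} < I m}`, where
`k_j` is the least index at which `H j` and `H i` differ and
`t_{j,m} = d j ∸ suffixDur dur (H j) m`. -/
def effDeadline {B : Type*} [DecidableEq B] {n : ℕ} (dur : B → ℕ)
    (H : Fin n → List B) (d : Fin n → ℕ) (i : Fin n) (I : ℕ → ℕ) (j : Fin n) : ℕ :=
  insert (d j)
    ((if commonPrefixLen (H j) (H i) < (H i).length then
        {I (commonPrefixLen (H j) (H i))} else (∅ : Finset ℕ)) ∪
      ((Finset.range (commonPrefixLen (H j) (H i))).filter fun m =>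
          d j - suffixDur dur (H j) m < I m).image
        fun m => d j - suffixDur dur (H j) m)
    |>.min' (Finset.insert_nonempty _ _)

/-- Success probability of a process with deadline `dl` and profile `M` allocated the
block `[b, b + t)`. -/
noncomputable def procSuccess (dl : ℕ) (M : ℕ → ℝ) (b t : ℕ) : ℝ :=
  if b ≤ dl then M (min t (dl - b)) else 0

/-- The durations of pairwise disjoint blocks of natural numbers below `D` sum up to
at most `D`. -/
theorem sum_le_of_pairwiseDisjoint_Ico {ι : Type*} (s : Finset ι) (b t : ι → ℕ) (D : ℕ)
    (hdisj : ∀ j ∈ s, ∀ j' ∈ s, j ≠ j' →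
      Disjoint (Set.Ico (b j) (b j + t j)) (Set.Ico (b j') (b j' + t j')))
    (hD : ∀ j ∈ s, 0 < t j → b j + t j ≤ D) : ∑ j ∈ s, t j ≤ D := by
  classical
  have hcard : (s.biUnion fun j => Finset.Ico (b j) (b j + t j)).card = ∑ j ∈ s, t j := by
    rw [Finset.card_biUnion fun j hj j' hj' h => by
      simpa [← Finset.disjoint_coe] using hdisj j hj j' hj' h]
    simp
  rw [← hcard, ← Finset.card_range D]
  refine Finset.card_le_card fun x hx => ?_
  simp only [Finset.mem_biUnion, Finset.mem_Ico] at hx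
  obtain ⟨j, hj, h1, h2⟩ := hx
  have := hD j hj (by omega)
  rw [Finset.mem_range]
  omega

/-- The start time of block `j` when the blocks, of durations `t`, are executed
back-to-back from time `0` in increasing order of `key`. -/
def packedStart {ι κ : Type*} [Fintype ι] [LinearOrder κ] (key : ι → κ) (t : ι → ℕ)
    (j : ι) : ℕ :=
  ∑ k with key k < key j, t k

section PackedStart

variable {ι κ : Type*} [Fintype ι] [LinearOrder κ] (key : ι → κ) (t : ι → ℕ)

theorem packedStart_add_le_of_lt {j j' : ι} (h : key j < key j') :
    packedStart key t j + t j ≤ packedStart key t j' := by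
  classical
  have hj : j ∉ ({k | key k < key j} : Finset ι) := by simp
  rw [packedStart, packedStart, add_comm, ← Finset.sum_insert hj]
  refine Finset.sum_le_sum_of_subset fun k hk => ?_
  rw [Finset.mem_insert, Finset.mem_filter_univ] at hk
  rw [Finset.mem_filter_univ]
  rcases hk with rfl | hk
  · exact h
  · exact hk.trans h

theorem packedStart_add_le_sum_filter (j : ι) :
    packedStart key t j + t j ≤ ∑ k with key k ≤ key j, t k := by
  classical
  have hj : j ∉ ({k | key k < key j} : Finset ι) := by simp
  rw [packedStart, add_comm, ← Finset.sum_insert hj]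
  refine Finset.sum_le_sum_of_subset fun k hk => ?_
  rw [Finset.mem_insert, Finset.mem_filter_univ] at hk
  rw [Finset.mem_filter_univ]
  rcases hk with rfl | hk
  · exact le_rfl
  · exact hk.le

theorem packedStart_add_le_sum (j : ι) : packedStart key t j + t j ≤ ∑ k, t k :=
  (packedStart_add_le_sum_filter key t j).trans
    (Finset.sum_le_sum_of_subset (Finset.filter_subset _ _))

variable {key}

theorem disjoint_packedStart (hkey : Function.Injective key) {j j' : ι} (h : j ≠ j') :
    Disjoint (Set.Ico (packedStart key t j) (packedStart key t j + t j))
      (Set.Ico (packedStart key t j') (packedStart key t j' + t j')) := by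
  rw [Set.disjoint_left]
  intro x hx hx'
  rw [Set.mem_Ico] at hx hx'
  rcases (hkey.ne h).lt_or_gt with hlt | hlt
  · have := packedStart_add_le_of_lt key t hlt
    omega
  · have := packedStart_add_le_of_lt key t hlt
    omega

theorem iUnion_Ico_packedStart (hkey : Function.Injective key) :
    (⋃ j, Set.Ico (packedStart key t j) (packedStart key t j + t j)) =
      Set.Ico 0 (∑ j, t j) := by
  classical
  have heq : (Finset.univ.biUnion fun j =>
      Finset.Ico (packedStart key t j) (packedStart key t j + t j)) =
      Finset.Ico 0 (∑ j, t j) := by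
    refine Finset.eq_of_subset_of_card_le (fun x hx => ?_) ?_
    · simp only [Finset.mem_biUnion, Finset.mem_Ico] at hx
      obtain ⟨j, -, -, hx⟩ := hx
      exact Finset.mem_Ico.2 ⟨x.zero_le, hx.trans_le (packedStart_add_le_sum key t j)⟩
    · rw [Finset.card_biUnion fun j _ j' _ h => by
        simpa [← Finset.disjoint_coe] using disjoint_packedStart t hkey h]
      simp
  simpa only [Finset.coe_biUnion, Finset.coe_Ico, Finset.mem_coe, Finset.mem_univ,
    Set.iUnion_true] using congrArg (fun s : Finset ℕ => (s : Set ℕ)) heq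

end PackedStart

theorem procSuccess_eq (dl : ℕ) (M : ℕ → ℝ) (hM : M 0 = 0) (b t : ℕ) :
    procSuccess dl M b t = M (min t (dl - b)) := by
  unfold procSuccess
  split_ifs with h
  · rfl
  · rw [Nat.sub_eq_zero_of_le (by omega), Nat.min_zero, hM]

/-- Moving a truncated block anywhere before the deadline preserves the success
probability. -/
theorem procSuccess_truncate (dl : ℕ) (M : ℕ → ℝ) (hM : M 0 = 0) (b t b' : ℕ)
    (h : 0 < min t (dl - b) → b' + min t (dl - b) ≤ dl) :
    procSuccess dl M b' (min t (dl - b)) = procSuccess dl M b t := by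
  rw [procSuccess_eq _ _ hM, procSuccess_eq _ _ hM]
  congr 1
  omega

/-- Theorem 6, concretized: fixing the base-level execution of `H i` to the legal
initiation function `I`, every schedule of computation blocks is dominated by one
whose positive-duration blocks are back-to-back from time 0, end no later than the
respective effective deadlines, and occur in nondecreasing order of effective
deadlines. -/
theorem stmt12 {B : Type*} [DecidableEq B] (n : ℕ) (dur : B → ℕ)
    (hdur : ∀ b, 1 ≤ dur b)
    (H : Fin n → List B) (d : Fin n → ℕ) (M : Fin n → ℕ → ℝ)
    (hMmono : ∀ j, Monotone (M j)) (hM0 : ∀ j, M j 0 = 0)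
    (hM01 : ∀ j t, 0 ≤ M j t ∧ M j t ≤ 1)
    (i : Fin n) (I : ℕ → ℕ)
    (hI : ∀ m (h : m + 1 < (H i).length),
      I m + dur ((H i).get ⟨m, Nat.lt_of_succ_lt h⟩) ≤ I (m + 1))
    (b t : Fin n → ℕ)
    (hdisj : ∀ j j', j ≠ j' →
      Disjoint (Set.Ico (b j) (b j + t j)) (Set.Ico (b j') (b j' + t j'))) :
    ∃ b' t' : Fin n → ℕ,
      (∀ j j', j ≠ j' →
        Disjoint (Set.Ico (b' j) (b' j + t' j)) (Set.Ico (b' j') (b' j' + t' j'))) ∧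
      (⋃ j, Set.Ico (b' j) (b' j + t' j)) = Set.Ico 0 (∑ j, t' j) ∧
      (∀ j, 0 < t' j → b' j + t' j ≤ effDeadline dur H d i I j) ∧
      (∀ j j', 0 < t' j → 0 < t' j' → b' j < b' j' →
        effDeadline dur H d i I j ≤ effDeadline dur H d i I j') ∧
      (1 - ∏ j, (1 - procSuccess (effDeadline dur H d i I j) (M j) (b j) (t j))) ≤
        (1 - ∏ j, (1 - procSuccess (effDeadline dur H d i I j) (M j) (b' j) (t' j))) := by
  set D := effDeadline dur H d i I
  set t' : Fin n → ℕ := fun j => min (t j) (D j - b j)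
  set key : Fin n → ℕ ×ₗ Fin n := fun j => toLex (D j, j)
  have hkey : Function.Injective key := fun j j' h => (Prod.ext_iff.1 (toLex.injective h)).2
  have hdisj' : ∀ j j', j ≠ j' →
      Disjoint (Set.Ico (b j) (b j + t' j)) (Set.Ico (b j') (b j' + t' j')) := fun j j' h =>
    (hdisj j j' h).mono (Set.Ico_subset_Ico_right (by grind))
      (Set.Ico_subset_Ico_right (by grind))
  have hdead : ∀ j, packedStart key t' j + t' j ≤ D j := fun j => by
    refine (packedStart_add_le_sum_filter key t' j).trans
      (sum_le_of_pairwiseDisjoint_Ico _ b t' (D j) (fun k _ k' _ => hdisj' k k') ?_)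
    intro k hk hpos
    have hle : D k ≤ D j := Prod.Lex.monotone_fst _ _ (Finset.mem_filter.1 hk).2
    grind
  refine ⟨packedStart key t', t', fun j j' => disjoint_packedStart t' hkey,
    iUnion_Ico_packedStart t' hkey, fun j _ => hdead j, fun j j' _ _ hlt => ?_, ?_⟩
  · by_contra! hD
    have := packedStart_add_le_of_lt key t' (Prod.Lex.toLex_lt_toLex.2 (Or.inl hD))
    omega
  · refine le_of_eq ?_
    congr 1
    refine Finset.prod_congr rfl fun j _ => ?_
    rw [procSuccess_truncate _ _ (hM0 j) _ _ _ fun _ => hdead j]
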